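/- arXiv:0708.0094 — 3 statements merged into one kernel-verified Lean document; each statement's English description precedes it below -/
import Mathlib

section
/- Let φ : [0,∞) → [0,∞) be convex with φ(0) = 0 and such that x ↦ φ(x)/x² is nondecreasing on (0,∞). Define the convex conjugate φ*(b) = sup_{a ≥ 0} (a·b − φ(a)). Then the function b ↦ φ*(b)/b² is nonincreasing on (0,∞). -/
open MeasureTheory ENNReal

/-- The convex conjugate `φ*(b) = sup_{a ≥ 0} (a·b - φ(a))` of a function
`φ : [0,∞) → [0,∞)`, with values in `[0,∞]`.  (The supremum is always
nonnegative since `a = 0` contributes `0` when `φ 0 = 0`.) -/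
noncomputable def convexConj (φ : ℝ → ℝ) (b : ℝ) : ℝ≥0∞ :=
  ⨆ a ∈ Set.Ici (0 : ℝ), ENNReal.ofReal (a * b - φ a)

/-- If `φ : [0,∞) → [0,∞)` is convex with `φ 0 = 0` and `x ↦ φ(x)/x²`
nondecreasing on `(0,∞)`, then `b ↦ φ*(b)/b²` is nonincreasing on `(0,∞)`. -/
theorem convexConj_div_sq_antitone
    (φ : ℝ → ℝ) (hφconv : ConvexOn ℝ (Set.Ici 0) φ) (hφ0 : φ 0 = 0)
    (hφnonneg : ∀ x, 0 ≤ x → 0 ≤ φ x)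
    (hφmono : ∀ x y : ℝ, 0 < x → x ≤ y → φ x / x ^ 2 ≤ φ y / y ^ 2) :
    ∀ b₁ b₂ : ℝ, 0 < b₁ → b₁ ≤ b₂ →
      convexConj φ b₂ / ENNReal.ofReal (b₂ ^ 2)
        ≤ convexConj φ b₁ / ENNReal.ofReal (b₁ ^ 2) := by
  intro b₁ b₂ hb₁ hb
  have hb₂ : 0 < b₂ := hb₁.trans_le hb
  refine ENNReal.div_le_of_le_mul (iSup₂_le fun a ha => ?_)
  have ha : 0 ≤ a := ha
  -- Test the supremum at `b₁` with the rescaled point `a * b₁ / b₂`.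
  have hc : 0 ≤ a * b₁ / b₂ := by positivity
  have hscale : φ (a * b₁ / b₂) / b₁ ^ 2 * b₂ ^ 2 ≤ φ a := by
    rcases ha.eq_or_lt with rfl | ha
    · simp [hφ0]
    have hle : a * b₁ / b₂ ≤ a := by
      rw [div_le_iff₀ hb₂]
      gcongr
    have h := hφmono _ a (by positivity) hle
    rw [le_div_iff₀ (by positivity)] at h
    refine le_of_eq_of_le ?_ h
    field_simp
  have hlin : a * b₁ / b₂ * b₁ / b₁ ^ 2 * b₂ ^ 2 = a * b₂ := by
    field_simp
  calc ENNReal.ofReal (a * b₂ - φ a)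
      ≤ ENNReal.ofReal ((a * b₁ / b₂ * b₁ - φ (a * b₁ / b₂)) / b₁ ^ 2 * b₂ ^ 2) := by
        apply ENNReal.ofReal_le_ofReal
        rw [sub_div, sub_mul, hlin]
        linarith
    _ = ENNReal.ofReal (a * b₁ / b₂ * b₁ - φ (a * b₁ / b₂)) / ENNReal.ofReal (b₁ ^ 2)
          * ENNReal.ofReal (b₂ ^ 2) := by
        rw [ENNReal.ofReal_mul' (by positivity), ENNReal.ofReal_div_of_pos (by positivity)]
    _ ≤ convexConj φ b₁ / ENNReal.ofReal (b₁ ^ 2) * ENNReal.ofReal (b₂ ^ 2) := by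
        gcongr
        exact le_iSup₂ (f := fun x (_ : x ∈ Set.Ici (0 : ℝ)) =>
          ENNReal.ofReal (x * b₁ - φ x)) _ hc
end

section
/- Let φ : [0,∞) → [0,∞) be convex with φ(0) = 0 and such that x ↦ φ(x)/x² is nondecreasing on (0,∞), and let φ*(b) = sup_{a ≥ 0} (a·b − φ(a)) be its convex conjugate. Then for every b > 0 and every c ≥ 1, φ*(c·b) ≤ c²·φ*(b). -/
open MeasureTheory ENNReal

/-- If `φ : [0,∞) → [0,∞)` is convex with `φ 0 = 0` and `x ↦ φ(x)/x²`
nondecreasing on `(0,∞)`, then for every `b > 0` and `c ≥ 1`,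
`φ*(c·b) ≤ c²·φ*(b)`. -/
theorem convexConj_scaling
    (φ : ℝ → ℝ) (hφconv : ConvexOn ℝ (Set.Ici 0) φ) (hφ0 : φ 0 = 0)
    (hφnonneg : ∀ x, 0 ≤ x → 0 ≤ φ x)
    (hφmono : ∀ x y : ℝ, 0 < x → x ≤ y → φ x / x ^ 2 ≤ φ y / y ^ 2) :
    ∀ b c : ℝ, 0 < b → 1 ≤ c →
      convexConj φ (c * b) ≤ ENNReal.ofReal (c ^ 2) * convexConj φ b := by
  intro b c _ hc
  have hc0 : 0 < c := lt_of_lt_of_le one_pos hc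
  refine iSup₂_le fun a ha => ?_
  have ha0 : 0 ≤ a := ha
  have key : c ^ 2 * φ (a / c) ≤ φ a := by
    rcases ha0.eq_or_lt with rfl | hpos
    · simp [hφ0]
    · have h := hφmono (a / c) a (div_pos hpos hc0) (div_le_self ha0 hc)
      rw [div_le_div_iff₀ (by positivity) (by positivity), div_pow, mul_div_assoc',
        le_div_iff₀ (by positivity)] at h
      exact le_of_mul_le_mul_right (by linarith) (pow_pos hpos 2)
  calc ENNReal.ofReal (a * (c * b) - φ a)
      ≤ ENNReal.ofReal (c ^ 2 * (a / c * b - φ (a / c))) := by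
        refine ENNReal.ofReal_le_ofReal ?_
        have : c ^ 2 * (a / c * b - φ (a / c)) = a * (c * b) - c ^ 2 * φ (a / c) := by
          field_simp
        linarith
    _ = ENNReal.ofReal (c ^ 2) * ENNReal.ofReal (a / c * b - φ (a / c)) :=
        ENNReal.ofReal_mul (sq_nonneg c)
    _ ≤ ENNReal.ofReal (c ^ 2) * convexConj φ b := by
        gcongr
        exact le_iSup₂ (f := fun a (_ : a ∈ Set.Ici (0 : ℝ)) => ENNReal.ofReal (a * b - φ a))
          (a / c) (div_nonneg ha0 hc0.le)
end

section
/- Let φ : [0,∞) → [0,∞) be convex with φ(0) = 0 and such that x ↦ φ(x)/x² is nondecreasing on (0,∞), and let φ*(b) = sup_{a ≥ 0} (a·b − φ(a)) be its convex conjugate. Let n ≥ 1 be an integer, ε ∈ (0,1], and y > 0 with 2y/ε ≥ 1. Then for every a ≥ 0: √(2y/n)·a ≤ ε·φ(a) + (2y/ε)·φ*(1/√n). -/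
open MeasureTheory ENNReal

/-- Quadratic scaling: if `x ↦ φ x / x ^ 2` is nondecreasing on `(0,∞)`, then
`φ (t * a) ≤ t ^ 2 * φ a` for `t ∈ (0,1]`. -/
theorem map_mul_le_sq_mul_of_div_sq_mono {φ : ℝ → ℝ} (hφ0 : φ 0 = 0)
    (hφmono : ∀ x y : ℝ, 0 < x → x ≤ y → φ x / x ^ 2 ≤ φ y / y ^ 2)
    {t a : ℝ} (ht0 : 0 < t) (ht1 : t ≤ 1) (ha : 0 ≤ a) :
    φ (t * a) ≤ t ^ 2 * φ a := by
  rcases ha.eq_or_lt with rfl | ha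
  · simp [hφ0]
  · have h := hφmono (t * a) a (by positivity) (mul_le_of_le_one_left ha.le ht1)
    rw [div_le_iff₀ (by positivity)] at h
    calc φ (t * a) ≤ φ a / a ^ 2 * (t * a) ^ 2 := h
      _ = t ^ 2 * φ a := by field_simp

/-- The Fenchel–Young inequality. -/
theorem ofReal_mul_sub_le_convexConj (φ : ℝ → ℝ) (b : ℝ) {a : ℝ} (ha : 0 ≤ a) :
    ENNReal.ofReal (a * b - φ a) ≤ convexConj φ b :=
  le_iSup₂ (f := fun a (_ : a ∈ Set.Ici (0 : ℝ)) => ENNReal.ofReal (a * b - φ a)) a ha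

/-- **Fenchel–Young inequality with scaling.**
If `φ : [0,∞) → [0,∞)` is convex with `φ 0 = 0` and `x ↦ φ(x)/x²`
nondecreasing on `(0,∞)`, then for `n ≥ 1`, `ε ∈ (0,1]`, `y > 0` with
`2y/ε ≥ 1`, and every `a ≥ 0`:
`√(2y/n)·a ≤ ε·φ(a) + (2y/ε)·φ*(1/√n)`. -/
theorem fenchel_young_scaled
    (φ : ℝ → ℝ) (hφconv : ConvexOn ℝ (Set.Ici 0) φ) (hφ0 : φ 0 = 0)
    (hφnonneg : ∀ x, 0 ≤ x → 0 ≤ φ x)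
    (hφmono : ∀ x y : ℝ, 0 < x → x ≤ y → φ x / x ^ 2 ≤ φ y / y ^ 2)
    (n : ℕ) (hn : 1 ≤ n) (ε y : ℝ) (hε0 : 0 < ε) (hε1 : ε ≤ 1)
    (hy : 0 < y) (hyε : 1 ≤ 2 * y / ε) :
    ∀ a : ℝ, 0 ≤ a →
      ENNReal.ofReal (Real.sqrt (2 * y / n) * a)
        ≤ ENNReal.ofReal (ε * φ a)
          + ENNReal.ofReal (2 * y / ε) * convexConj φ (1 / Real.sqrt n) := by
  intro a ha
  set s := Real.sqrt (2 * y)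
  have hs0 : 0 < s := Real.sqrt_pos.2 (by positivity)
  have hs2 : s ^ 2 = 2 * y := Real.sq_sqrt (by positivity)
  have hεs : ε ≤ s := by
    rw [one_le_div hε0] at hyε
    exact Real.le_sqrt_of_sq_le (by nlinarith)
  have ht0 : 0 < ε / s := by positivity
  have hscale := map_mul_le_sq_mul_of_div_sq_mono hφ0 hφmono ht0 ((div_le_one hs0).2 hεs) ha
  have hconj := ofReal_mul_sub_le_convexConj φ (1 / Real.sqrt n) (mul_nonneg ht0.le ha)
  refine le_trans ?_ (add_le_add_right (mul_le_mul_right hconj _) _)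
  rw [← ENNReal.ofReal_mul (by positivity)]
  refine le_trans (ENNReal.ofReal_le_ofReal ?_) ENNReal.ofReal_add_le
  have hφ : 2 * y / ε * φ (ε / s * a) ≤ ε * φ a :=
    calc 2 * y / ε * φ (ε / s * a) ≤ 2 * y / ε * ((ε / s) ^ 2 * φ a) := by gcongr
      _ = ε * φ a := by rw [← hs2]; field_simp
  have hlin : Real.sqrt (2 * y / n) * a
      = 2 * y / ε * (ε / s * a * (1 / Real.sqrt n)) := by
    rw [Real.sqrt_div (by positivity), ← hs2, Real.sqrt_sq hs0.le]
    field_simp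
  rw [hlin, mul_sub]
  linarith
end
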